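/- Asymptotic deterministic version of Theorem 1. Let S be a type, A a finite nonempty type of actions containing a distinguished control action 0, and τ : S → A → ℝ with τ s 0 = 0 for all s. Suppose (ε_N)_{N ≥ 1} is a sequence of nonnegative reals with ε_N → 0, and (K_N) is a sequence of natural numbers with 1 ≤ K_N ≤ N and K_N / N → c for some c with 0 < c ≤ 1. For each N, let s^N : Fin N → S be a state vector, τ̂_N : S → A → ℝ a function with |τ (s^N i) a − τ̂_N (s^N i) a| ≤ ε_N for all i and all a ∈ A, π_N an induced top-K_N policy for τ̂_N at s^N, and π*_N an induced top-K_N policy for τ at s^N. Then (1/K_N) ∑_{i} ( τ (s^N i) (π_N i) − τ (s^N i) (π*_N i) ) → 0 as N → ∞. -/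

import Mathlib

open Filter

/-- `π` is an induced top-`K` policy for `f` at state vector `s`. -/
def IsTopKPolicy {S A : Type*} [Fintype A] [Nonempty A] [Zero A] {N : ℕ}
    (f : S → A → ℝ) (s : Fin N → S) (K : ℕ) (π : Fin N → A) : Prop :=
  ∃ T : Finset (Fin N), T.card = K ∧
    (∀ i ∈ T, ∀ j ∉ T,
      Finset.univ.sup' Finset.univ_nonempty (f (s j)) ≤
        Finset.univ.sup' Finset.univ_nonempty (f (s i))) ∧
    (∀ i ∈ T, f (s i) (π i) = Finset.univ.sup' Finset.univ_nonempty (f (s i))) ∧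
    (∀ i ∉ T, π i = 0)

theorem topK_sum_le {ι : Type*} [DecidableEq ι] (g : ι → ℝ) (T U : Finset ι)
    (hc : T.card = U.card) (h : ∀ i ∈ T, ∀ j ∉ T, g j ≤ g i) :
    ∑ i ∈ U, g i ≤ ∑ i ∈ T, g i := by
  have hcard : (U \ T).card = (T \ U).card := by
    have h1 := Finset.card_sdiff_add_card_inter U T
    have h2 := Finset.card_sdiff_add_card_inter T U
    rw [Finset.inter_comm] at h2
    omega
  have h1 := Finset.sum_inter_add_sum_sdiff U T g
  have h2 := Finset.sum_inter_add_sum_sdiff T U g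
  rw [Finset.inter_comm] at h2
  have key : ∑ i ∈ U \ T, g i ≤ ∑ i ∈ T \ U, g i := by
    rcases (T \ U).eq_empty_or_nonempty with he | hne
    · rw [he, Finset.card_empty, Finset.card_eq_zero] at hcard
      rw [he, hcard]
    · obtain ⟨m, hm, hmin⟩ := Finset.exists_min_image (T \ U) g hne
      have a := Finset.sum_le_card_nsmul (U \ T) g (g m) (fun j hj =>
        h m (Finset.mem_sdiff.1 hm).1 j (Finset.mem_sdiff.1 hj).2)
      have b := Finset.card_nsmul_le_sum (T \ U) g (g m) hmin
      rw [hcard] at a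
      exact a.trans b
  linarith

theorem topK_regret_bound {S A : Type*} [Fintype A] [Nonempty A] [Zero A] {N : ℕ}
    (τ f : S → A → ℝ) (hτ0 : ∀ x : S, τ x 0 = 0) (e : ℝ) (K : ℕ) (s : Fin N → S)
    (herr : ∀ (i : Fin N) (a : A), |τ (s i) a - f (s i) a| ≤ e)
    (p q : Fin N → A) (hp : IsTopKPolicy f s K p) (hq : IsTopKPolicy τ s K q) :
    -(2 * K * e) ≤ ∑ i, (τ (s i) (p i) - τ (s i) (q i)) ∧
      ∑ i, (τ (s i) (p i) - τ (s i) (q i)) ≤ 0 := by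
  obtain ⟨T, hT, hT1, hT2, hT3⟩ := hp
  obtain ⟨U, hU, hU1, hU2, hU3⟩ := hq
  have e1 : ∑ i, τ (s i) (p i) = ∑ i ∈ T, τ (s i) (p i) :=
    (Finset.sum_subset (Finset.subset_univ T) (fun i _ hi => by rw [hT3 i hi, hτ0])).symm
  have e2 : ∑ i, τ (s i) (q i) = ∑ i ∈ U, τ (s i) (q i) :=
    (Finset.sum_subset (Finset.subset_univ U) (fun i _ hi => by rw [hU3 i hi, hτ0])).symm
  have e3 := Finset.sum_congr rfl hU2
  have a1 := topK_sum_le _ U T (hU.trans hT.symm) hU1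
  have a2 := topK_sum_le _ T U (hT.trans hU.symm) hT1
  have e4 := Finset.sum_congr rfl hT2
  have b1 : ∑ i ∈ T, τ (s i) (p i) ≤
      ∑ i ∈ T, Finset.univ.sup' Finset.univ_nonempty (τ (s i)) :=
    Finset.sum_le_sum (fun i _ => Finset.le_sup' (τ (s i)) (Finset.mem_univ _))
  have b2 : ∑ i ∈ T, (f (s i) (p i) - e) ≤ ∑ i ∈ T, τ (s i) (p i) :=
    Finset.sum_le_sum (fun i _ => by linarith [(abs_le.1 (herr i (p i))).1])
  have b3 : ∑ i ∈ U, (τ (s i) (q i) - e) ≤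
      ∑ i ∈ U, Finset.univ.sup' Finset.univ_nonempty (f (s i)) :=
    Finset.sum_le_sum (fun i _ => by
      have := Finset.le_sup' (f (s i)) (Finset.mem_univ (q i))
      linarith [(abs_le.1 (herr i (q i))).2])
  rw [Finset.sum_sub_distrib, Finset.sum_const, nsmul_eq_mul] at b2 b3
  rw [hT] at b2
  rw [hU] at b3
  rw [Finset.sum_sub_distrib, e1, e2]
  constructor <;> linarith

/-- Asymptotic deterministic version of Theorem 1: if the uniform estimation
errors `ε N` tend to zero and `K N / N → c ∈ (0, 1]`, then the per-capita
regret of the top-`K N` policies induced by the estimates `τ̂ N` relative to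
the top-`K N` policies induced by `τ` tends to zero. -/
theorem topK_policy_regret_tendsto_zero
    {S A : Type*} [Fintype A] [Nonempty A] [Zero A]
    (τ : S → A → ℝ) (hτ0 : ∀ x : S, τ x 0 = 0)
    (ε : ℕ → ℝ) (hε : ∀ N, 1 ≤ N → 0 ≤ ε N)
    (hεlim : Tendsto ε atTop (nhds 0))
    (K : ℕ → ℕ) (hK1 : ∀ N, 1 ≤ N → 1 ≤ K N) (hKN : ∀ N, 1 ≤ N → K N ≤ N)
    (c : ℝ) (hc0 : 0 < c) (hc1 : c ≤ 1)
    (hKlim : Tendsto (fun N => (K N : ℝ) / (N : ℝ)) atTop (nhds c))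
    (s : (N : ℕ) → Fin N → S)
    (τhat : ℕ → S → A → ℝ)
    (herr : ∀ N, 1 ≤ N → ∀ (i : Fin N) (a : A),
      |τ (s N i) a - τhat N (s N i) a| ≤ ε N)
    (π : (N : ℕ) → Fin N → A)
    (hπ : ∀ N, 1 ≤ N → IsTopKPolicy (τhat N) (s N) (K N) (π N))
    (πstar : (N : ℕ) → Fin N → A)
    (hπstar : ∀ N, 1 ≤ N → IsTopKPolicy τ (s N) (K N) (πstar N)) :
    Tendsto
      (fun N => (1 / (K N : ℝ)) *
        ∑ i, (τ (s N i) (π N i) - τ (s N i) (πstar N i)))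
      atTop (nhds 0) := by
  have hlow : Tendsto (fun N => -(2 * ε N)) atTop (nhds 0) := by
    simpa using (hεlim.const_mul 2).neg
  refine tendsto_of_tendsto_of_tendsto_of_le_of_le' hlow tendsto_const_nhds ?_ ?_
  all_goals
    filter_upwards [eventually_ge_atTop 1] with N hN
    obtain ⟨h1, h2⟩ := topK_regret_bound τ (τhat N) hτ0 (ε N) (K N) (s N) (herr N hN)
      (π N) (πstar N) (hπ N hN) (hπstar N hN)
    have hKpos : (0 : ℝ) < K N := by exact_mod_cast hK1 N hN
  · rw [one_div, inv_mul_eq_div, le_div_iff₀ hKpos]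
    linarith
  · exact mul_nonpos_of_nonneg_of_nonpos (by positivity) h2
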